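/- arXiv:2205.01828 — 8 statements merged into one kernel-verified Lean document; each statement's English description precedes it below -/
import Mathlib

section
/- Suppose r = 2m+1 and q are coprime. Then every row of the matrix R contains at most two nonzero entries; that is, for each i with 1 ≤ i ≤ m, the number of column indices l ∈ {0,…,m−1} for which the entry of R in row i and column l is nonzero is at most 2. -/
open scoped Classical

/-- The reduced index `ρ(n) = min(n % r, r − n % r)`. -/
noncomputable def rho (r n : ℕ) : ℕ := min (n % r) (r - n % r)

/-- The sign `σ(n) = (−1)^⌊n/r⌋`. -/
noncomputable def sgn (r n : ℕ) : ℤ := (-1) ^ (n / r)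

/-- The entry of the matrix `R` in row (labelled) `i ∈ {1,…,m}` and column `l ∈ {0,…,m−1}`:
column `0` is `e_1`, and for `1 ≤ l ≤ m−1` the column is the reduction of
`f_l = e_{ql+1} − A^{2pl} e_{ql−1}`. -/
noncomputable def Rent (m q : ℕ) (p : ℤ) (A : ℂ) (i l : ℕ) : ℂ :=
  if l = 0 then (if i = 1 then 1 else 0)
  else
    (if rho (2*m+1) (q*l+1) = i then ((sgn (2*m+1) (q*l+1) : ℤ) : ℂ) else 0)
      - A ^ (2 * p * (l : ℤ)) *
        (if rho (2*m+1) (q*l-1) = i then ((sgn (2*m+1) (q*l-1) : ℤ) : ℂ) else 0)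

/-- The matrix `R`, with rows indexed by `i = 1,…,m` and columns by `l = 0,…,m−1`. -/
noncomputable def Rmat (m q : ℕ) (p : ℤ) (A : ℂ) : Matrix (Fin m) (Fin m) ℂ :=
  fun i l => Rent m q p A ((i : ℕ) + 1) (l : ℕ)

/-- If `rho r n = i` then `n ≡ ±i` modulo `r`. -/
lemma dvd_sub_or_dvd_add_of_rho_eq {r n i : ℕ} (hr : 0 < r) (h : rho r n = i) :
    (r : ℤ) ∣ n - i ∨ (r : ℤ) ∣ n + i := by
  have hdiv : (r : ℤ) * ((n / r : ℕ) : ℤ) + ((n % r : ℕ) : ℤ) = n := by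
    exact_mod_cast Nat.div_add_mod n r
  have hlt := Nat.mod_lt n hr
  unfold rho at h
  rcases min_choice (n % r) (r - n % r) with hmin | hmin <;> rw [hmin] at h
  · left
    exact ⟨((n / r : ℕ) : ℤ), by rw [← h]; linarith⟩
  · right
    have hi : (i : ℤ) = r - ((n % r : ℕ) : ℤ) := by omega
    exact ⟨((n / r : ℕ) : ℤ) + 1, by rw [hi]; linarith⟩

/-- Among `0, …, m - 1` at most one `l` satisfies `q * l ≡ ±k` modulo `2 * m + 1`. -/
lemma card_filter_mul_congr_le_one {m q : ℕ} (hco : Nat.Coprime (2 * m + 1) q) (k : ℤ) :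
    ((Finset.range m).filter (fun l : ℕ => ((2 * m + 1 : ℕ) : ℤ) ∣ (q : ℤ) * l - k ∨
      ((2 * m + 1 : ℕ) : ℤ) ∣ (q : ℤ) * l + k)).card ≤ 1 := by
  have hco' : IsCoprime ((2 * m + 1 : ℕ) : ℤ) (q : ℤ) := Nat.isCoprime_iff_coprime.mpr hco
  refine Finset.card_le_one.mpr fun a ha b hb => ?_
  simp only [Finset.mem_filter, Finset.mem_range] at ha hb
  obtain ⟨ham, ha⟩ := ha
  obtain ⟨hbm, hb⟩ := hb
  have key : ((2 * m + 1 : ℕ) : ℤ) ∣ (a : ℤ) - b ∨ ((2 * m + 1 : ℕ) : ℤ) ∣ (a : ℤ) + b := by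
    rcases ha with ha | ha <;> rcases hb with hb | hb
    · exact .inl (hco'.dvd_of_dvd_mul_left (by convert dvd_sub ha hb using 1; ring))
    · exact .inr (hco'.dvd_of_dvd_mul_left (by convert dvd_add ha hb using 1; ring))
    · exact .inr (hco'.dvd_of_dvd_mul_left (by convert dvd_add ha hb using 1; ring))
    · exact .inl (hco'.dvd_of_dvd_mul_left (by convert dvd_sub ha hb using 1; ring))
  rcases key with h | h
  · have := Int.eq_zero_of_abs_lt_dvd h (by rw [abs_lt]; constructor <;> omega)
    omega
  · have := Int.eq_zero_of_abs_lt_dvd h (by rw [abs_lt]; constructor <;> omega)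
    omega

/-- A nonzero entry in row `i` and column `l` forces `q * l ≡ ±(i - 1)` or `q * l ≡ ±(i + 1)`
modulo `2 * m + 1`. -/
lemma mul_congr_of_Rent_ne_zero {m q i l : ℕ} {p : ℤ} {A : ℂ} (hq : 0 < q)
    (h : Rent m q p A i l ≠ 0) :
    (((2 * m + 1 : ℕ) : ℤ) ∣ (q : ℤ) * l - ((i : ℤ) - 1) ∨
      ((2 * m + 1 : ℕ) : ℤ) ∣ (q : ℤ) * l + ((i : ℤ) - 1)) ∨
    (((2 * m + 1 : ℕ) : ℤ) ∣ (q : ℤ) * l - ((i : ℤ) + 1) ∨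
      ((2 * m + 1 : ℕ) : ℤ) ∣ (q : ℤ) * l + ((i : ℤ) + 1)) := by
  have hr : 0 < 2 * m + 1 := by omega
  unfold Rent at h
  by_cases hl : l = 0
  · rw [if_pos hl] at h
    have hi : i = 1 := by
      by_contra hi
      exact h (if_neg hi)
    subst hl hi
    simp
  rw [if_neg hl] at h
  by_cases hplus : rho (2 * m + 1) (q * l + 1) = i
  · rcases dvd_sub_or_dvd_add_of_rho_eq hr hplus with hd | hd
    · exact .inl (.inl (by convert hd using 1; push_cast; ring))
    · exact .inr (.inr (by convert hd using 1; push_cast; ring))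
  by_cases hminus : rho (2 * m + 1) (q * l - 1) = i
  · have hpos : 1 ≤ q * l := Nat.mul_pos hq (Nat.pos_of_ne_zero hl)
    rcases dvd_sub_or_dvd_add_of_rho_eq hr hminus with hd | hd
    · exact .inr (.inl (by convert hd using 1; push_cast [hpos]; ring))
    · exact .inl (.inr (by convert hd using 1; push_cast [hpos]; ring))
  · simp [hplus, hminus] at h

/-- Every row of `R` contains at most two nonzero entries. -/
theorem stmt_0 (m q : ℕ) (hm : 0 < m) (hq : 0 < q)
    (hco : Nat.Coprime (2*m+1) q) (p : ℤ) (A : ℂ)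
    (hA : IsPrimitiveRoot A (2*(2*m+1))) :
    ∀ i : ℕ, 1 ≤ i → i ≤ m →
      ((Finset.range m).filter (fun l => Rent m q p A i l ≠ 0)).card ≤ 2 := by
  intro i _ _
  refine (Finset.card_le_card (Finset.monotone_filter_right _ fun l _ hl =>
    mul_congr_of_Rent_ne_zero hq hl)).trans ?_
  rw [Finset.filter_or]
  exact (Finset.card_union_le _ _).trans (add_le_add
    (card_filter_mul_congr_le_one hco _) (card_filter_mul_congr_le_one hco _))
end

section
/- Suppose m ≥ 2 and r = 2m+1 is coprime to q. Then for every l with 1 ≤ l ≤ m−1, the reduced indices ρ(ql+1) and ρ(ql−1) are distinct and differ by at most 2, i.e., ρ(ql+1) ≠ ρ(ql−1) and |ρ(ql+1) − ρ(ql−1)| ≤ 2. -/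
/-- For `1 ≤ l ≤ m−1`, the reduced indices `ρ(ql+1)` and `ρ(ql−1)` are distinct and
differ by at most `2`. -/
theorem stmt_1 (m q : ℕ) (hm : 2 ≤ m) (hq : 0 < q)
    (hco : Nat.Coprime (2*m+1) q) :
    ∀ l : ℕ, 1 ≤ l → l ≤ m - 1 →
      rho (2*m+1) (q*l+1) ≠ rho (2*m+1) (q*l-1) ∧
      ((rho (2*m+1) (q*l+1) : ℤ) - (rho (2*m+1) (q*l-1) : ℤ)).natAbs ≤ 2 := by
  intro l hl hlm
  have hs : q * l % (2*m+1) ≠ 0 := fun h => by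
    have := Nat.le_of_dvd hl (hco.dvd_of_dvd_mul_left (Nat.dvd_of_mod_eq_zero h))
    omega
  have hlt : q * l % (2*m+1) < 2*m+1 := Nat.mod_lt _ (by omega)
  have hdiv := Nat.mod_add_div (q * l) (2*m+1)
  unfold rho
  generalize q * l % (2*m+1) = s at *
  generalize q * l / (2*m+1) = k at *
  have hpred : (q * l - 1) % (2*m+1) = s - 1 := by
    rw [← hdiv, show s + (2*m+1) * k - 1 = (s - 1) + (2*m+1) * k by omega,
      Nat.add_mul_mod_self_left, Nat.mod_eq_of_lt (by omega)]
  have hsucc : (q * l + 1) % (2*m+1) = if s = 2*m then 0 else s + 1 := by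
    rw [← hdiv, show s + (2*m+1) * k + 1 = (s + 1) + (2*m+1) * k by omega,
      Nat.add_mul_mod_self_left]
    split_ifs with h
    · rw [h, Nat.mod_self]
    · exact Nat.mod_eq_of_lt (by omega)
  rw [hpred, hsucc]
  clear hdiv hpred hsucc
  split_ifs <;> omega
end

section
/- Suppose q is even with q ≥ 4, r = 2m+1 is coprime to q, and m > (q+5)/2. Then row q/2 − 1 and row q/2 + 1 of the matrix R each contain exactly one nonzero entry, and the columns containing these two entries are distinct. -/
open scoped Classical

/-- `a` is congruent to `c` or `-c` modulo `r`. -/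
def CongrUpToSign (r a c : ℤ) : Prop := r ∣ a - c ∨ r ∣ a + c

theorem CongrUpToSign.trans {r a b c : ℤ} (h : CongrUpToSign r a b) (h' : CongrUpToSign r a c) :
    CongrUpToSign r b c := by
  rcases h with h | h <;> rcases h' with h' | h'
  · left; convert Int.dvd_sub h' h using 1; ring
  · right; convert Int.dvd_sub h' h using 1; ring
  · right; convert Int.dvd_sub h h' using 1; ring
  · left; convert Int.dvd_sub h h' using 1; ring

theorem CongrUpToSign.eq {r b c : ℤ} (h : CongrUpToSign r b c) (hb : 0 ≤ b) (hc : 0 ≤ c)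
    (hbc : b + c < r) : b = c := by
  rcases h with h | h
  · have := Int.eq_zero_of_abs_lt_dvd h (by rw [abs_lt]; constructor <;> linarith)
    linarith
  · have := Int.eq_zero_of_dvd_of_nonneg_of_lt (by linarith) hbc h
    linarith

theorem rho_eq_iff {m n i : ℕ} (hi : 1 ≤ i) (him : i ≤ m) :
    rho (2 * m + 1) n = i ↔ CongrUpToSign (2 * m + 1) n i := by
  have hlt : n % (2 * m + 1) < 2 * m + 1 := Nat.mod_lt _ (by omega)
  have hdiv : ((2 * m + 1 : ℕ) : ℤ) ∣ (n : ℤ) - (n % (2 * m + 1) : ℕ) := by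
    rw [Int.natCast_mod]; exact Int.dvd_self_sub_emod
  unfold rho
  generalize n % (2 * m + 1) = k at *
  push_cast at hdiv
  constructor
  · intro h
    rcases min_choice k (2 * m + 1 - k) with h' | h'
    · left; rwa [← h, h']
    · right
      have hk : (k : ℤ) = 2 * m + 1 - i := by omega
      convert Int.dvd_add hdiv (dvd_refl _) using 1
      · rw [hk]; ring
  · intro h
    rcases Nat.lt_or_ge m k with hkm | hkm
    · have hk : CongrUpToSign (2 * m + 1) n (2 * m + 1 - k) := by
        right
        convert Int.dvd_add hdiv (dvd_refl _) using 1
        ring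
      have := (hk.trans h).eq (by omega) (by omega) (by omega)
      omega
    · have := (CongrUpToSign.trans (Or.inl hdiv) h).eq (by omega) (by omega) (by omega)
      omega

theorem congrUpToSign_mul_left_cancel {m q l l' : ℕ} {c : ℤ} (hco : Nat.Coprime (2 * m + 1) q)
    (hl : l ≤ m) (hl' : l' ≤ m) (h : CongrUpToSign (2 * m + 1) (q * l) c)
    (h' : CongrUpToSign (2 * m + 1) (q * l') c) : l = l' := by
  have hco' : IsCoprime (2 * m + 1 : ℤ) q := by exact_mod_cast Nat.isCoprime_iff_coprime.2 hco
  have hs : CongrUpToSign (2 * m + 1) (l : ℤ) l' := by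
    have aux (x : ℤ) (hx : (2 * m + 1 : ℤ) ∣ q * x) : (2 * m + 1 : ℤ) ∣ x :=
      hco'.dvd_of_dvd_mul_left hx
    rcases h with h | h <;> rcases h' with h' | h'
    · left; apply aux; convert Int.dvd_sub h h' using 1; ring
    · right; apply aux; convert Int.dvd_add h h' using 1; ring
    · right; apply aux; convert Int.dvd_add h h' using 1; ring
    · left; apply aux; convert Int.dvd_sub h h' using 1; ring
  exact_mod_cast hs.eq (by omega) (by omega) (by omega)

theorem exists_mul_congrUpToSign {m q : ℕ} (hco : Nat.Coprime (2 * m + 1) q) (c : ℤ) :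
    ∃ l : ℕ, l ≤ m ∧ CongrUpToSign (2 * m + 1) (q * l) c := by
  obtain ⟨u, v, huv⟩ : IsCoprime (2 * m + 1 : ℤ) q := by
    exact_mod_cast Nat.isCoprime_iff_coprime.2 hco
  have hk0 := Int.emod_nonneg (v * c) (show (2 * m + 1 : ℤ) ≠ 0 by omega)
  have hk1 := Int.emod_lt_of_pos (v * c) (show (0 : ℤ) < 2 * m + 1 by omega)
  have hk2 := Int.emod_add_mul_ediv (v * c) (2 * m + 1)
  generalize v * c % (2 * m + 1) = k at *
  generalize v * c / (2 * m + 1) = t at *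
  lift k to ℕ using hk0
  rcases Nat.lt_or_ge m k with h | h
  · refine ⟨2 * m + 1 - k, by omega, Or.inr ⟨q + q * t + u * c, ?_⟩⟩
    have hcast : ((2 * m + 1 - k : ℕ) : ℤ) = 2 * m + 1 - k := by omega
    rw [hcast]
    linear_combination (-q : ℤ) * hk2 - c * huv
  · refine ⟨k, h, Or.inl ⟨-u * c - q * t, ?_⟩⟩
    linear_combination (q : ℤ) * hk2 + c * huv

theorem Rent_ne_zero_iff {m q i l : ℕ} {p : ℤ} {A : ℂ} (hA : A ≠ 0) (hq : 0 < q)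
    (hco : Nat.Coprime (2 * m + 1) q) (hi : 1 ≤ i) (him : i + 1 ≤ m) (hl : l < m) :
    Rent m q p A i l ≠ 0 ↔
      CongrUpToSign (2 * m + 1) (q * l) (i - 1) ∨ CongrUpToSign (2 * m + 1) (q * l) (i + 1) := by
  rcases Nat.eq_zero_or_pos l with rfl | hl0
  · have h0 : CongrUpToSign (2 * m + 1) (q * (0 : ℕ)) 0 := by left; simp
    simp only [Rent, if_true, ne_eq, ite_eq_right_iff, one_ne_zero, imp_false, not_not]
    constructor
    · rintro rfl
      left; simpa using h0
    · rintro (h | h)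
      · have := (h0.trans h).eq le_rfl (by omega) (by omega)
        omega
      · have := (h0.trans h).eq le_rfl (by omega) (by omega)
        omega
  · have hql : 1 ≤ q * l := Nat.mul_pos hq hl0
    have hsgn (n : ℕ) : ((sgn (2 * m + 1) n : ℤ) : ℂ) ≠ 0 := by simp [sgn]
    have hpow : A ^ (2 * p * (l : ℤ)) ≠ 0 := zpow_ne_zero _ hA
    have hnot : ¬ CongrUpToSign (2 * m + 1) (q * l) 0 := fun h =>
      hl0.ne' (congrUpToSign_mul_left_cancel hco hl.le (Nat.zero_le m) h (by left; simp))
    have hcast : ((q * l - 1 : ℕ) : ℤ) = q * l - 1 := by push_cast [hql]; ring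
    have htwo : ¬ (2 * m + 1 : ℤ) ∣ 2 := fun h => by
      have := Int.le_of_dvd two_pos h
      omega
    have hdouble : ¬ (2 * m + 1 : ℤ) ∣ 2 * (q * l) := fun h =>
      hnot (Or.inl (by
        rw [sub_zero]
        exact IsCoprime.dvd_of_dvd_mul_left ⟨1, -m, by ring⟩ h))
    have hexcl : ¬ (CongrUpToSign (2 * m + 1) ((q * l + 1 : ℕ) : ℤ) i ∧
        CongrUpToSign (2 * m + 1) ((q * l - 1 : ℕ) : ℤ) i) := by
      rw [hcast]
      push_cast
      rintro ⟨h | h, h' | h'⟩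
      · exact htwo (by convert Int.dvd_sub h h' using 1; ring)
      · exact hdouble (by convert Int.dvd_add h h' using 1; ring)
      · exact hdouble (by convert Int.dvd_add h h' using 1; ring)
      · exact htwo (by convert Int.dvd_sub h h' using 1; ring)
    have hsplit : (CongrUpToSign (2 * m + 1) ((q * l + 1 : ℕ) : ℤ) i ∨
        CongrUpToSign (2 * m + 1) ((q * l - 1 : ℕ) : ℤ) i) ↔
        CongrUpToSign (2 * m + 1) (q * l) (i - 1) ∨
          CongrUpToSign (2 * m + 1) (q * l) (i + 1) := by
      rw [hcast]
      push_cast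
      unfold CongrUpToSign
      rw [show (q * l - (i - 1) : ℤ) = q * l + 1 - i by ring,
        show (q * l + (i - 1) : ℤ) = q * l - 1 + i by ring,
        show (q * l - (i + 1) : ℤ) = q * l - 1 - i by ring,
        show (q * l + (i + 1) : ℤ) = q * l + 1 + i by ring]
      tauto
    rw [← hsplit]
    simp only [Rent, hl0.ne', if_false, rho_eq_iff hi (Nat.le_of_succ_le him)]
    by_cases h : CongrUpToSign (2 * m + 1) ((q * l + 1 : ℕ) : ℤ) i <;>
      by_cases h' : CongrUpToSign (2 * m + 1) ((q * l - 1 : ℕ) : ℤ) i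
    · exact absurd ⟨h, h'⟩ hexcl
    · simp only [h, h', if_true, if_false]
      simpa only [mul_zero, sub_zero, true_or, ne_eq, iff_true] using hsgn _
    · simp only [h, h', if_true, if_false]
      simpa only [zero_sub, or_true, ne_eq, iff_true, neg_eq_zero] using mul_ne_zero hpow (hsgn _)
    · simp only [h, h', if_false, mul_zero, sub_zero, ne_eq, not_true_eq_false, or_self]

/-- If the congruence class of `b` is only hit by the excluded column `m`, then the row is
supported on the unique column hitting the class of `c`. -/
theorem filter_Rent_ne_zero_eq_singleton {m q i k : ℕ} {p : ℤ} {A : ℂ} {b c : ℤ} (hA : A ≠ 0)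
    (hq : 0 < q) (hco : Nat.Coprime (2 * m + 1) q) (hi : 1 ≤ i) (him : i + 1 ≤ m)
    (hbc : (b = i + 1 ∧ c = i - 1) ∨ (b = i - 1 ∧ c = i + 1))
    (hb : CongrUpToSign (2 * m + 1) (q * m) b) (hkm : k ≤ m)
    (hk : CongrUpToSign (2 * m + 1) (q * k) c) :
    (Finset.range m).filter (fun l => Rent m q p A i l ≠ 0) = {k} := by
  have hne : k ≠ m := by
    rintro rfl
    rcases hbc with ⟨rfl, rfl⟩ | ⟨rfl, rfl⟩
    · have := (hb.trans hk).eq (by omega) (by omega) (by omega)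
      omega
    · have := (hb.trans hk).eq (by omega) (by omega) (by omega)
      omega
  ext l
  rw [Finset.mem_filter, Finset.mem_range, Finset.mem_singleton]
  constructor
  · rintro ⟨hl, h⟩
    have h' : CongrUpToSign (2 * m + 1) (q * l) b ∨ CongrUpToSign (2 * m + 1) (q * l) c := by
      rw [Rent_ne_zero_iff hA hq hco hi him hl] at h
      rcases hbc with ⟨rfl, rfl⟩ | ⟨rfl, rfl⟩
      exacts [h.symm, h]
    rcases h' with h' | h'
    · exact absurd (congrUpToSign_mul_left_cancel hco hl.le le_rfl h' hb) hl.ne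
    · exact congrUpToSign_mul_left_cancel hco hl.le hkm h' hk
  · rintro rfl
    have hl : l < m := lt_of_le_of_ne hkm hne
    refine ⟨hl, (Rent_ne_zero_iff hA hq hco hi him hl).2 ?_⟩
    rcases hbc with ⟨rfl, rfl⟩ | ⟨rfl, rfl⟩
    exacts [Or.inl hk, Or.inr hk]

/-- For even `q ≥ 4`, rows `q/2 − 1` and `q/2 + 1` of `R` each contain exactly one
nonzero entry, and the columns containing these two entries are distinct. -/
theorem stmt_5 (m q : ℕ) (hm : 0 < m) (hq : 0 < q) (hqe : Even q) (hq4 : 4 ≤ q)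
    (hco : Nat.Coprime (2*m+1) q) (hmq : q + 5 < 2*m) (p : ℤ) (A : ℂ)
    (hA : IsPrimitiveRoot A (2*(2*m+1))) :
    ∃ cminus cplus : ℕ, cminus ≠ cplus ∧
      (Finset.range m).filter (fun l => Rent m q p A (q/2 - 1) l ≠ 0) = {cminus} ∧
      (Finset.range m).filter (fun l => Rent m q p A (q/2 + 1) l ≠ 0) = {cplus} := by
  have hA0 : A ≠ 0 := hA.ne_zero (by omega)
  obtain ⟨h, rfl⟩ := hqe
  have hhalf : (h + h) / 2 = h := by omega
  rw [hhalf]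
  have hm' : CongrUpToSign (2 * m + 1) (((h + h : ℕ) : ℤ) * m) h :=
    Or.inr ⟨h, by push_cast; ring⟩
  obtain ⟨a, ham, ha⟩ := exists_mul_congrUpToSign hco ((h : ℤ) - 2)
  obtain ⟨b, hbm, hb⟩ := exists_mul_congrUpToSign hco ((h : ℤ) + 2)
  refine ⟨a, b, ?_, ?_, ?_⟩
  · rintro rfl
    have := (ha.trans hb).eq (by omega) (by omega) (by omega)
    omega
  · exact filter_Rent_ne_zero_eq_singleton hA0 hq hco (by omega) (by omega)
      (Or.inl ⟨by omega, by omega⟩) hm' ham ha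
  · exact filter_Rent_ne_zero_eq_singleton hA0 hq hco (by omega) (by omega)
      (Or.inr ⟨by omega, by omega⟩) hm' hbm hb
end

section
/- Suppose q ≥ 2, r = 2m+1 is coprime to q, and m > (q+5)/2. Then there exists a unique integer l' with 1 ≤ l' ≤ m−1 such that |ρ(ql'+1) − ρ(ql'−1)| = 1; moreover, for this l' one has {ρ(ql'+1), ρ(ql'−1)} = {m−1, m} as sets. -/
theorem Nat.succ_mod_eq_ite (r n : ℕ) (hr : 1 < r) :
    (n + 1) % r = if n % r = r - 1 then 0 else n % r + 1 := by
  have hlt : n % r < r := Nat.mod_lt _ (by omega)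
  rw [Nat.add_mod, Nat.mod_eq_of_lt hr]
  split_ifs with h
  · rw [h, Nat.sub_add_cancel hr.le, Nat.mod_self]
  · exact Nat.mod_eq_of_lt (by omega)

/-- Reduced indices of the two neighbours of `n` differ by one exactly when `n` is congruent to
`m` or `m + 1`; the reduced indices are then `m - 1` and `m`. -/
theorem rho_neighbours (m n : ℕ) (hm : 2 ≤ m) (hn : 1 ≤ n) :
    (((rho (2*m+1) (n+1) : ℤ) - (rho (2*m+1) (n-1) : ℤ)).natAbs = 1 ↔
      n % (2*m+1) = m ∨ n % (2*m+1) = m + 1) ∧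
    (n % (2*m+1) = m → rho (2*m+1) (n+1) = m ∧ rho (2*m+1) (n-1) = m - 1) ∧
    (n % (2*m+1) = m + 1 → rho (2*m+1) (n+1) = m - 1 ∧ rho (2*m+1) (n-1) = m) := by
  obtain ⟨k, rfl⟩ : ∃ k, n = k + 1 := ⟨n - 1, by omega⟩
  have h₁ := Nat.succ_mod_eq_ite (2*m+1) k (by omega)
  have h₂ := Nat.succ_mod_eq_ite (2*m+1) (k+1) (by omega)
  have h₃ : k % (2*m+1) < 2*m+1 := Nat.mod_lt _ (by omega)
  simp only [rho, Nat.add_sub_cancel]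
  generalize k % (2*m+1) = a at *
  generalize (k+1) % (2*m+1) = b at *
  generalize (k+1+1) % (2*m+1) = c at *
  split_ifs at h₁ h₂ <;> omega

theorem mod_eq_half_iff_dvd (m n : ℕ) (hm : 0 < m) :
    (n % (2*m+1) = m ∨ n % (2*m+1) = m + 1) ↔
      ((2*m+1 : ℤ) ∣ n - m ∨ (2*m+1 : ℤ) ∣ n + m) := by
  have hlt : n % (2*m+1) < 2*m+1 := Nat.mod_lt _ (by omega)
  have hdiv : (n : ℤ) = (2*m+1) * (n / (2*m+1) : ℕ) + (n % (2*m+1) : ℕ) := by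
    exact_mod_cast (Nat.div_add_mod n (2*m+1)).symm
  generalize n % (2*m+1) = a at *
  generalize n / (2*m+1) = k at *
  constructor
  · rintro (rfl | rfl)
    · exact Or.inl ⟨k, by rw [hdiv]; ring⟩
    · exact Or.inr ⟨k + 1, by rw [hdiv]; push_cast; ring⟩
  · rintro (h | h)
    · have h' : (2*m+1 : ℤ) ∣ a - m := by
        have := dvd_sub h (Dvd.intro (k : ℤ) rfl)
        rwa [hdiv, show (2*m+1 : ℤ) * k + a - m - (2*m+1) * k = a - m by ring] at this
      have := Int.eq_zero_of_abs_lt_dvd h' (by rw [abs_lt]; omega)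
      omega
    · have h' : (2*m+1 : ℤ) ∣ a - m - 1 := by
        have := dvd_sub h (Dvd.intro (k + 1 : ℤ) rfl)
        rwa [hdiv, show (2*m+1 : ℤ) * k + a + m - (2*m+1) * (k + 1) = a - m - 1 by ring] at this
      have := Int.eq_zero_of_abs_lt_dvd h' (by rw [abs_lt]; omega)
      omega

/-- Multiplication by a unit `q` modulo `2m+1` hits `±m` at exactly one `l` in `[1, m-1]`, provided
`q` is not congruent to `±1`. -/
theorem existsUnique_dvd_mul_sub_or_add (m q : ℕ) (hm : 0 < m) (hq : 2 ≤ q)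
    (hco : Nat.Coprime (2*m+1) q) (hmq : q < 2*m) :
    ∃! l : ℕ, (1 ≤ l ∧ l ≤ m - 1) ∧
      ((2*m+1 : ℤ) ∣ (q*l : ℕ) - m ∨ (2*m+1 : ℤ) ∣ (q*l : ℕ) + m) := by
  have hcop : IsCoprime (2*m+1 : ℤ) q := by
    exact_mod_cast Nat.isCoprime_iff_coprime.mpr hco
  have hcopm : IsCoprime (2*m+1 : ℤ) m := ⟨1, -2, by ring⟩
  have hnem : ¬ ((2*m+1 : ℤ) ∣ (q*m : ℕ) - m ∨ (2*m+1 : ℤ) ∣ (q*m : ℕ) + m) := by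
    rintro (h | h)
    · have h' : (2*m+1 : ℤ) ∣ q - 1 := hcopm.dvd_of_dvd_mul_right
        (h.trans (dvd_of_eq (by push_cast; ring)))
      have := Int.eq_zero_of_abs_lt_dvd h' (by rw [abs_lt]; omega)
      omega
    · have h' : (2*m+1 : ℤ) ∣ q + 1 := hcopm.dvd_of_dvd_mul_right
        (h.trans (dvd_of_eq (by push_cast; ring)))
      have := Int.eq_zero_of_abs_lt_dvd h' (by rw [abs_lt]; omega)
      omega
  have hex : ∃ l : ℕ, (1 ≤ l ∧ l ≤ m) ∧
      ((2*m+1 : ℤ) ∣ (q*l : ℕ) - m ∨ (2*m+1 : ℤ) ∣ (q*l : ℕ) + m) := by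
    obtain ⟨a, b, hab⟩ := hcop
    have hu₀ := Int.emod_nonneg (b * m) (show (2*m+1 : ℤ) ≠ 0 by omega)
    have hu₁ := Int.emod_lt_of_pos (b * m) (show (0 : ℤ) < 2*m+1 by omega)
    have hdiv := Int.mul_ediv_add_emod (b * m) (2*m+1)
    generalize b * m / (2*m+1 : ℤ) = k at *
    generalize b * m % (2*m+1 : ℤ) = u at *
    have hdvd : (2*m+1 : ℤ) ∣ q * u - m :=
      ⟨-(a * m) - q * k, by linear_combination (q : ℤ) * hdiv + (m : ℤ) * hab⟩
    lift u to ℕ using hu₀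
    have hu : u ≠ 0 := by
      rintro rfl
      have := Int.eq_zero_of_abs_lt_dvd hdvd (by rw [abs_lt]; push_cast; omega)
      push_cast at this
      omega
    by_cases hum : u ≤ m
    · exact ⟨u, ⟨by omega, hum⟩, Or.inl (by exact_mod_cast hdvd)⟩
    · refine ⟨2*m+1-u, ⟨by omega, by omega⟩, Or.inr ?_⟩
      have hle : u ≤ 2*m+1 := by omega
      obtain ⟨c, hc⟩ := hdvd
      refine ⟨q - c, ?_⟩
      push_cast [Nat.cast_sub hle]
      linear_combination -hc
  obtain ⟨l, ⟨hl₁, hlm⟩, hl⟩ := hex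
  have hlne : l ≠ m := by
    rintro rfl
    exact hnem hl
  refine ⟨l, ⟨⟨hl₁, by omega⟩, hl⟩, ?_⟩
  rintro l' ⟨⟨hl'₁, hl'm⟩, hl'⟩
  have hpm : (2*m+1 : ℤ) ∣ (l' : ℤ) - l ∨ (2*m+1 : ℤ) ∣ (l' : ℤ) + l := by
    rcases hl with ⟨c, hc⟩ | ⟨c, hc⟩ <;> rcases hl' with ⟨d, hd⟩ | ⟨d, hd⟩ <;> push_cast at hc hd
    · exact Or.inl (hcop.dvd_of_dvd_mul_left ⟨d - c, by linear_combination hd - hc⟩)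
    · exact Or.inr (hcop.dvd_of_dvd_mul_left ⟨d + c, by linear_combination hd + hc⟩)
    · exact Or.inr (hcop.dvd_of_dvd_mul_left ⟨d + c, by linear_combination hd + hc⟩)
    · exact Or.inl (hcop.dvd_of_dvd_mul_left ⟨d - c, by linear_combination hd - hc⟩)
  rcases hpm with h | h <;>
  · have := Int.eq_zero_of_abs_lt_dvd h (by rw [abs_lt]; omega)
    omega

/-- There is a unique `l` with `1 ≤ l ≤ m−1` such that `ρ(ql+1)` and `ρ(ql−1)` differ
by exactly `1`; moreover for this `l`, `{ρ(ql+1), ρ(ql−1)} = {m−1, m}`. -/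
theorem stmt_9 (m q : ℕ) (hm : 0 < m) (hq : 2 ≤ q)
    (hco : Nat.Coprime (2*m+1) q) (hmq : q + 5 < 2*m) :
    (∃! l : ℕ, (1 ≤ l ∧ l ≤ m - 1) ∧
      ((rho (2*m+1) (q*l+1) : ℤ) - (rho (2*m+1) (q*l-1) : ℤ)).natAbs = 1) ∧
    (∀ l : ℕ, (1 ≤ l ∧ l ≤ m - 1) →
      ((rho (2*m+1) (q*l+1) : ℤ) - (rho (2*m+1) (q*l-1) : ℤ)).natAbs = 1 →
      ({rho (2*m+1) (q*l+1), rho (2*m+1) (q*l-1)} : Set ℕ) = {m - 1, m}) := by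
  have hpos : ∀ l : ℕ, 1 ≤ l → 1 ≤ q * l := fun l hl => Nat.mul_pos (by omega) hl
  constructor
  · refine (existsUnique_congr fun l => and_congr_right fun hl => ?_).mpr
      (existsUnique_dvd_mul_sub_or_add m q hm hq hco (by omega))
    rw [(rho_neighbours m (q*l) (by omega) (hpos l hl.1)).1, mod_eq_half_iff_dvd _ _ hm]
  · intro l hl h
    obtain ⟨hiff, hlow, hhigh⟩ := rho_neighbours m (q*l) (by omega) (hpos l hl.1)
    rcases hiff.mp h with h' | h'
    · rw [(hlow h').1, (hlow h').2, Set.pair_comm]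
    · rw [(hhigh h').1, (hhigh h').2]
end

section
/- Suppose q ≥ 3, r = 2m+1 is coprime to q, and m > (q+5)/2. Then there exists an integer l with 1 ≤ l ≤ m−1 such that r divides ql+1 or r divides ql−1 (i.e., the unique such l in {1,…,m} in fact satisfies l ≤ m−1). -/
/-- A unit modulo `2m+1` has, up to sign, an inverse in `{1, …, m}`. -/
theorem exists_mul_add_one_or_sub_one_dvd (m q : ℕ) (hm : 0 < m)
    (hco : Nat.Coprime (2 * m + 1) q) :
    ∃ l : ℕ, 1 ≤ l ∧ l ≤ m ∧
      ((2 * m + 1 : ℤ) ∣ q * l + 1 ∨ (2 * m + 1 : ℤ) ∣ q * l - 1) := by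
  obtain ⟨a, ha, h⟩ := Nat.exists_mul_mod_eq_one_of_coprime hco.symm (by omega)
  have hdvd : (2 * m + 1 : ℤ) ∣ q * a - 1 := by
    refine ⟨(q * a / (2 * m + 1) : ℕ), ?_⟩
    have e := Nat.div_add_mod (q * a) (2 * m + 1)
    rw [h] at e
    zify at e ⊢
    linarith
  have ha0 : a ≠ 0 := by
    rintro rfl
    simp at h
  by_cases hle : a ≤ m
  · exact ⟨a, by omega, hle, Or.inr hdvd⟩
  · refine ⟨2 * m + 1 - a, by omega, by omega, Or.inl ?_⟩
    obtain ⟨c, hc⟩ := hdvd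
    refine ⟨q - c, ?_⟩
    rw [Nat.cast_sub ha.le]
    push_cast
    linear_combination -hc

/-- For `q ≥ 3` and `2m+1 > q+6`, there exists `l` with `1 ≤ l ≤ m−1` such that
`r = 2m+1` divides `ql+1` or `ql−1`. -/
theorem stmt_10 (m q : ℕ) (hm : 0 < m) (hq : 3 ≤ q)
    (hco : Nat.Coprime (2*m+1) q) (hmq : q + 5 < 2*m) :
    ∃ l : ℕ, 1 ≤ l ∧ l ≤ m - 1 ∧ ((2*m+1) ∣ (q*l+1) ∨ (2*m+1) ∣ (q*l-1)) := by
  obtain ⟨l, h1, hle, h⟩ := exists_mul_add_one_or_sub_one_dvd m q hm hco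
  have hne : l ≠ m := by
    rintro rfl
    rcases h with ⟨c, hc⟩ | ⟨c, hc⟩
    · have hd : (2 * l + 1 : ℤ) ∣ q - 2 := ⟨q - 2 * c, by linear_combination -2 * hc⟩
      have := Int.le_of_dvd (by omega) hd
      omega
    · have hd : (2 * l + 1 : ℤ) ∣ q + 2 := ⟨q - 2 * c, by linear_combination -2 * hc⟩
      have := Int.le_of_dvd (by omega) hd
      omega
  have hpos : 1 ≤ q * l := Nat.mul_pos (by omega) h1
  refine ⟨l, h1, by omega, h.imp (fun h => ?_) (fun h => ?_)⟩
  · exact_mod_cast h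
  · zify [hpos]
    exact h
end

section
/- Suppose r = 2m+1 is coprime to q and m > (q+5)/2. Then the matrix R is nonsingular, i.e., det R ≠ 0. -/
open scoped Classical

/-- The reduced index only depends on the class of `n` modulo `r` up to sign. -/
theorem rho_eq_of_dvd {r a b : ℕ} (hr : 0 < r)
    (h : (r : ℤ) ∣ (a : ℤ) - b ∨ (r : ℤ) ∣ (a : ℤ) + b) : rho r a = rho r b := by
  have ha := Nat.mod_lt a hr
  have hb := Nat.mod_lt b hr
  unfold rho
  rcases h with h | h
  · have : a % r = b % r := by
      have h1 : b ≡ a [MOD r] := (Nat.modEq_iff_dvd).2 h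
      exact h1.symm
    rw [this]
  · have h1 : r ∣ a + b := by exact_mod_cast h
    have h2 : r ∣ a % r + b % r := by
      rw [Nat.dvd_iff_mod_eq_zero] at h1 ⊢
      rwa [← Nat.add_mod]
    obtain ⟨c, hc⟩ := h2
    have hc2 : c < 2 := by
      by_contra! hcon
      nlinarith
    interval_cases c <;> omega

/-- A property holding at both ends of a path with at most one broken edge holds everywhere. -/
theorem forall_le_of_iff_succ {m : ℕ} {P B : ℕ → Prop} (h0 : P 0) (hm : P m)
    (hB : ∀ j k, j < k → k < m → B j → ¬ B k)
    (hP : ∀ k < m, ¬ B k → (P k ↔ P (k + 1))) : ∀ k ≤ m, P k := by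
  intro k hk
  by_cases h : ∃ j < k, B j
  · obtain ⟨j, hj, hBj⟩ := h
    induction hk using Nat.decreasingInduction with
    | self => exact hm
    | of_succ n hn ih => exact (hP n hn (hB j n hj hn hBj)).2 (ih (by omega))
  · push Not at h
    induction k with
    | zero => exact h0
    | succ n ih =>
      exact (hP n hk (h n (by omega))).1 (ih (by omega) fun j hj => h j (by omega))

/-- Modulo an odd `r = 2m+1`, every nonzero class is up to sign a multiple `q l` with
`1 ≤ l ≤ m`. -/
theorem exists_mul_dvd_sub_or_add {m q c : ℕ} (hco : Nat.Coprime (2*m+1) q)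
    (hc : 0 < c) (hc' : c < 2*m+1) :
    ∃ l, 1 ≤ l ∧ l ≤ m ∧ (((2*m+1 : ℕ) : ℤ) ∣ (q : ℤ) * l - c ∨
      ((2*m+1 : ℕ) : ℤ) ∣ (q : ℤ) * l + c) := by
  obtain ⟨x, hx⟩ : ∃ x : ℤ, ((2*m+1 : ℕ) : ℤ) ∣ (q : ℤ) * x - c := by
    have h := Nat.gcd_eq_gcd_ab (2*m+1) q
    rw [hco] at h
    refine ⟨Nat.gcdB (2*m+1) q * c, -(Nat.gcdA (2*m+1) q * c), ?_⟩
    linear_combination -(c : ℤ) * h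
  obtain ⟨d, hd⟩ := hx
  have hr : (0 : ℤ) < ((2*m+1 : ℕ) : ℤ) := by positivity
  have e := Int.emod_add_mul_ediv x ((2*m+1 : ℕ) : ℤ)
  have h0 := Int.emod_nonneg x hr.ne'
  have h1 := Int.emod_lt_of_pos x hr
  set y := x % ((2*m+1 : ℕ) : ℤ)
  set z := x / ((2*m+1 : ℕ) : ℤ)
  have hy : ((2*m+1 : ℕ) : ℤ) ∣ (q : ℤ) * y - c :=
    ⟨d - q * z, by linear_combination hd + (q : ℤ) * e⟩
  have hy0 : y ≠ 0 := by
    intro hy0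
    rw [hy0, mul_zero, zero_sub, dvd_neg, Int.natCast_dvd_natCast] at hy
    exact absurd (Nat.le_of_dvd hc hy) (by omega)
  by_cases hym : y ≤ m
  · refine ⟨y.toNat, by omega, by omega, Or.inl ?_⟩
    rwa [Int.toNat_of_nonneg h0]
  · refine ⟨(((2*m+1 : ℕ) : ℤ) - y).toNat, by omega, by omega, Or.inr ?_⟩
    rw [Int.toNat_of_nonneg (by omega)]
    obtain ⟨f, hf⟩ := hy
    exact ⟨q - f, by linear_combination -hf⟩

/-- Distinct odd numbers below `2m` are inequivalent modulo `2m+1` up to sign. -/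
theorem not_dvd_of_dvd_odd {m j k : ℕ} {x : ℤ} (hjk : j < k) (hk : k < m)
    (hj : ((2*m+1 : ℕ) : ℤ) ∣ x - (2*j+1 : ℕ) ∨ ((2*m+1 : ℕ) : ℤ) ∣ x + (2*j+1 : ℕ)) :
    ¬ (((2*m+1 : ℕ) : ℤ) ∣ x - (2*k+1 : ℕ) ∨ ((2*m+1 : ℕ) : ℤ) ∣ x + (2*k+1 : ℕ)) := by
  have hcop : IsCoprime ((2*m+1 : ℕ) : ℤ) 2 := ⟨1, -m, by push_cast; ring⟩
  have hsum : ¬ ((2*m+1 : ℕ) : ℤ) ∣ 2 * ((j + k + 1 : ℕ) : ℤ) := fun h =>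
    absurd (Nat.le_of_dvd (by omega) (Int.natCast_dvd_natCast.1 (hcop.dvd_of_dvd_mul_left h)))
      (by omega)
  have hdiff : ¬ ((2*m+1 : ℕ) : ℤ) ∣ 2 * ((k - j : ℕ) : ℤ) := fun h =>
    absurd (Nat.le_of_dvd (by omega) (Int.natCast_dvd_natCast.1 (hcop.dvd_of_dvd_mul_left h)))
      (by omega)
  rw [Nat.cast_sub hjk.le] at hdiff
  rintro (hk' | hk') <;> rcases hj with hj | hj
  · exact hdiff (by convert Int.dvd_sub hj hk' using 1; push_cast; ring)
  · exact hsum (by convert Int.dvd_sub hj hk' using 1; push_cast; ring)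
  · exact hsum (by convert Int.dvd_sub hk' hj using 1; push_cast; ring)
  · exact hdiff (by convert Int.dvd_sub hk' hj using 1; push_cast; ring)

/-- The extension of `v`, indexed by `1, …, m`, by zero to all of `ℕ`. -/
noncomputable def extendByZero {m : ℕ} (v : Fin m → ℂ) (n : ℕ) : ℂ :=
  ∑ i : Fin m, if n = (i : ℕ) + 1 then v i else 0

theorem extendByZero_zero {m : ℕ} (v : Fin m → ℂ) : extendByZero v 0 = 0 := by
  simp [extendByZero]

theorem extendByZero_succ {m : ℕ} (v : Fin m → ℂ) (i : Fin m) :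
    extendByZero v ((i : ℕ) + 1) = v i := by
  simp [extendByZero, Fin.val_inj]

theorem sum_mul_ite_eq_extendByZero {m : ℕ} (v : Fin m → ℂ) (n : ℕ) (s : ℂ) :
    ∑ i : Fin m, v i * (if n = (i : ℕ) + 1 then s else 0) = extendByZero v n * s := by
  simp only [extendByZero, Finset.sum_mul, mul_ite, ite_mul, mul_zero, zero_mul]

theorem sgn_cast_ne_zero (r n : ℕ) : ((sgn r n : ℤ) : ℂ) ≠ 0 := by
  simp [sgn]

theorem vecMul_Rmat_zero {m q : ℕ} {p : ℤ} {A : ℂ} (v : Fin m → ℂ) (hm : 0 < m) :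
    Matrix.vecMul v (Rmat m q p A) ⟨0, hm⟩ = extendByZero v 1 := by
  simp only [Matrix.vecMul, dotProduct, Rmat, Rent, if_true]
  rw [← mul_one (extendByZero v 1), ← sum_mul_ite_eq_extendByZero]
  simp only [eq_comm]

theorem vecMul_Rmat_of_ne_zero {m q : ℕ} {p : ℤ} {A : ℂ} (v : Fin m → ℂ) {l : ℕ}
    (hl : l ≠ 0) (hlm : l < m) :
    Matrix.vecMul v (Rmat m q p A) ⟨l, hlm⟩ =
      extendByZero v (rho (2*m+1) (q*l+1)) * ((sgn (2*m+1) (q*l+1) : ℤ) : ℂ) -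
      A ^ (2 * p * (l : ℤ)) *
        (extendByZero v (rho (2*m+1) (q*l-1)) * ((sgn (2*m+1) (q*l-1) : ℤ) : ℂ)) := by
  simp only [Matrix.vecMul, dotProduct, Rmat, Rent, if_neg hl]
  rw [← sum_mul_ite_eq_extendByZero, ← sum_mul_ite_eq_extendByZero, Finset.mul_sum,
    ← Finset.sum_sub_distrib]
  exact Finset.sum_congr rfl fun i _ => by ring

theorem extendByZero_rho_iff {m q : ℕ} {p : ℤ} {A : ℂ} (hA : A ≠ 0) {v : Fin m → ℂ}
    (hv : Matrix.vecMul v (Rmat m q p A) = 0) {l : ℕ} (hl : l ≠ 0) (hlm : l < m) :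
    extendByZero v (rho (2*m+1) (q*l+1)) = 0 ↔ extendByZero v (rho (2*m+1) (q*l-1)) = 0 := by
  have h := congrFun hv ⟨l, hlm⟩
  rw [vecMul_Rmat_of_ne_zero v hl hlm, Pi.zero_apply, sub_eq_zero] at h
  have := sgn_cast_ne_zero (2*m+1) (q*l+1)
  have := sgn_cast_ne_zero (2*m+1) (q*l-1)
  have := zpow_ne_zero (2 * p * (l : ℤ)) hA
  constructor <;> intro h' <;> simp_all

theorem extendByZero_rho_two_mul {m q : ℕ} {p : ℤ} {A : ℂ} (hm : 0 < m) (hq : 0 < q)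
    (hco : Nat.Coprime (2*m+1) q) (hA : A ≠ 0) {v : Fin m → ℂ}
    (hv : Matrix.vecMul v (Rmat m q p A) = 0) :
    ∀ k ≤ m, extendByZero v (rho (2*m+1) (2*k)) = 0 := by
  refine forall_le_of_iff_succ (B := fun k => ((2*m+1 : ℕ) : ℤ) ∣ (q : ℤ) * m - (2*k+1 : ℕ) ∨
    ((2*m+1 : ℕ) : ℤ) ∣ (q : ℤ) * m + (2*k+1 : ℕ)) ?_ ?_
    (fun j k hjk hk hj => not_dvd_of_dvd_odd hjk hk hj) ?_
  · simpa [rho] using extendByZero_zero v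
  · have h : rho (2*m+1) (2*m) = 1 := by
      rw [rho, Nat.mod_eq_of_lt (by omega)]
      omega
    rw [h, ← vecMul_Rmat_zero (q := q) (p := p) (A := A) v hm, hv, Pi.zero_apply]
  · intro k hk hB
    obtain ⟨l, hl, hlm, h⟩ := exists_mul_dvd_sub_or_add (c := 2*k+1) hco (by omega) (by omega)
    have hlm' : l < m := lt_of_le_of_ne hlm (by rintro rfl; exact hB h)
    have key := extendByZero_rho_iff hA hv (by omega) hlm'
    have hql : 1 ≤ q * l := Nat.mul_pos hq hl
    have hr : 0 < 2*m+1 := by omega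
    rcases h with h | h
    · rw [rho_eq_of_dvd (b := 2*(k+1)) hr (Or.inl (by convert h using 1; push_cast; ring)),
        rho_eq_of_dvd (a := q*l-1) (b := 2*k) hr
          (Or.inl (by convert h using 1; push_cast [Nat.cast_sub hql]; ring))] at key
      exact key.symm
    · rwa [rho_eq_of_dvd (b := 2*k) hr (Or.inr (by convert h using 1; push_cast; ring)),
        rho_eq_of_dvd (a := q*l-1) (b := 2*(k+1)) hr
          (Or.inr (by convert h using 1; push_cast [Nat.cast_sub hql]; ring))] at key

/-- If `r = 2m+1` is coprime to `q` and `m > (q+5)/2`, the matrix `R` is nonsingular. -/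
theorem stmt_11 (m q : ℕ) (hm : 0 < m) (hq : 0 < q)
    (hco : Nat.Coprime (2*m+1) q) (hmq : q + 5 < 2*m) (p : ℤ) (A : ℂ)
    (hA : IsPrimitiveRoot A (2*(2*m+1))) :
    (Rmat m q p A).det ≠ 0 := by
  intro hdet
  obtain ⟨v, hv0, hv⟩ := Matrix.exists_vecMul_eq_zero_iff.2 hdet
  have hz := extendByZero_rho_two_mul hm hq hco (hA.ne_zero (by omega)) hv
  refine hv0 (funext fun i => ?_)
  have hi := i.isLt
  obtain ⟨k, hk, hki⟩ : ∃ k ≤ m, rho (2*m+1) (2*k) = (i : ℕ) + 1 := by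
    rcases Nat.even_or_odd' ((i : ℕ) + 1) with ⟨c, hc | hc⟩
    · refine ⟨c, by omega, ?_⟩
      rw [rho, Nat.mod_eq_of_lt (by omega)]
      omega
    · refine ⟨m - c, by omega, ?_⟩
      rw [rho, Nat.mod_eq_of_lt (by omega)]
      omega
  rw [← extendByZero_succ v i, ← hki, hz k hk, Pi.zero_apply]
end

section
/- Suppose m ≥ 2 and the greatest common divisor of r = 2m+1 and q is greater than 1. Then the matrix R is singular, i.e., det R = 0. -/
open scoped Classical

/-- Modulo a divisor `g` of `r`, the reduced index of `n` is `n` or `-n`. -/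
theorem dvd_sub_rho_or_dvd_add_rho {g r : ℕ} (hr : 0 < r) (hg : g ∣ r) (n : ℕ) :
    (g : ℤ) ∣ n - rho r n ∨ (g : ℤ) ∣ n + rho r n := by
  have hgr : (g : ℤ) ∣ r := Int.natCast_dvd_natCast.mpr hg
  have hdiv : (r : ℤ) * (n / r : ℕ) + (n % r : ℕ) = n := by
    exact_mod_cast Nat.div_add_mod n r
  rcases min_choice (n % r) (r - n % r) with h | h
  · left
    rw [rho, h, show (n : ℤ) - (n % r : ℕ) = r * (n / r : ℕ) by linarith]
    exact hgr.mul_right _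
  · right
    rw [rho, h, Nat.cast_sub (Nat.mod_lt n hr).le,
      show (n : ℤ) + (r - (n % r : ℕ)) = r * ((n / r : ℕ) + 1) by linarith]
    exact hgr.mul_right _

/-- If `g` divides `r` and `n` is `±1` modulo `g`, then so is the reduced index of `n`. -/
theorem dvd_rho_sub_one_or_dvd_rho_add_one {g r n : ℕ} (hr : 0 < r) (hg : g ∣ r)
    (hn : (g : ℤ) ∣ n - 1 ∨ (g : ℤ) ∣ n + 1) :
    (g : ℤ) ∣ rho r n - 1 ∨ (g : ℤ) ∣ rho r n + 1 := by
  rcases dvd_sub_rho_or_dvd_add_rho hr hg n with ⟨a, ha⟩ | ⟨a, ha⟩ <;>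
    rcases hn with ⟨b, hb⟩ | ⟨b, hb⟩
  · exact Or.inl ⟨b - a, by linarith⟩
  · exact Or.inr ⟨b - a, by linarith⟩
  · exact Or.inr ⟨a - b, by linarith⟩
  · exact Or.inl ⟨a - b, by linarith⟩

/-- Rows of `R` whose label is not `±1` modulo a common divisor of `2m+1` and `q` vanish. -/
theorem Rent_eq_zero {g m q : ℕ} (hq : 0 < q) (hgr : g ∣ 2 * m + 1) (hgq : g ∣ q) (p : ℤ)
    (A : ℂ) {i : ℕ} (hi : ¬((g : ℤ) ∣ i - 1 ∨ (g : ℤ) ∣ i + 1)) (l : ℕ) :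
    Rent m q p A i l = 0 := by
  have hgql : (g : ℤ) ∣ q * l := (Int.natCast_dvd_natCast.mpr hgq).mul_right _
  unfold Rent
  have hplus : rho (2 * m + 1) (q * l + 1) ≠ i := by
    rintro rfl
    refine hi (dvd_rho_sub_one_or_dvd_rho_add_one (by omega) hgr (Or.inl ?_))
    simpa using hgql
  by_cases hl : l = 0
  · have hi1 : i ≠ 1 := by
      rintro rfl
      simp at hi
    simp [hl, hi1]
  have hminus : rho (2 * m + 1) (q * l - 1) ≠ i := by
    have hpos : 1 ≤ q * l := Nat.mul_pos hq (Nat.pos_of_ne_zero hl)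
    rintro rfl
    refine hi (dvd_rho_sub_one_or_dvd_rho_add_one (by omega) hgr (Or.inr ?_))
    rw [Nat.cast_sub hpos]
    simpa using hgql
  simp [hl, hplus, hminus]

/-- A divisor `g > 1` of `2m+1`, with `m ≥ 2`, leaves a label in `{1,…,m}` that is not `±1`
modulo `g`. -/
theorem exists_label_not_dvd {g m : ℕ} (hm : 2 ≤ m) (hg : 1 < g) (hgr : g ∣ 2 * m + 1) :
    ∃ k < m, ¬((g : ℤ) ∣ ((k + 1 : ℕ) : ℤ) - 1 ∨ (g : ℤ) ∣ ((k + 1 : ℕ) : ℤ) + 1) := by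
  obtain ⟨c, hc⟩ := hgr
  by_cases hgm : g ≤ m
  · refine ⟨g - 1, by omega, ?_⟩
    rw [Nat.sub_add_cancel hg.le]
    have hone : ¬(g : ℤ) ∣ 1 := fun h => by
      have := Int.le_of_dvd one_pos h
      omega
    rintro (h | h)
    · exact hone ((dvd_sub_right dvd_rfl).mp h)
    · exact hone ((dvd_add_right dvd_rfl).mp h)
  · refine ⟨1, by omega, ?_⟩
    have hc1 : c = 1 := by
      have h0 : c ≠ 0 := by rintro rfl; omega
      by_contra h1
      have : 2 ≤ c := by omega
      nlinarith
    subst hc1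
    rintro (h | h) <;>
    · have := Int.le_of_dvd (by norm_num) h
      push_cast at this
      omega

/-- If `gcd(2m+1, q) > 1`, the matrix `R` is singular. -/
theorem stmt_12 (m q : ℕ) (hm : 2 ≤ m) (hq : 0 < q)
    (hgcd : 1 < Nat.gcd (2*m+1) q) (p : ℤ) (A : ℂ)
    (hA : IsPrimitiveRoot A (2*(2*m+1))) :
    (Rmat m q p A).det = 0 := by
  obtain ⟨k, hk, hi⟩ := exists_label_not_dvd hm hgcd (Nat.gcd_dvd_left _ _)
  exact Matrix.det_eq_zero_of_row_eq_zero ⟨k, hk⟩ fun l =>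
    Rent_eq_zero hq (Nat.gcd_dvd_left _ _) (Nat.gcd_dvd_right _ _) p A hi l
end

section
/- Let q be an integer, let i ≥ 1 be an integer, and let C and x be nonzero complex numbers. Then the sum over all integers n with |n| ≤ i−1 and n ≡ i−1 (mod 2) of C^(−(qn²+2n))·(x^(qn+1) − x^(−(qn+1))) equals the sum over all integers n with 0 ≤ n ≤ i−1 and n ≡ i−1 (mod 2) of t_n, where t_0 = x − x^(−1) and, for n ≥ 1, t_n = C^(−(qn²+2n))·((x^(qn+1) − x^(−(qn+1))) − C^(4n)·(x^(qn−1) − x^(−(qn−1)))). (All powers are integer powers of the nonzero complex numbers C and x.) -/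
/-- A sum over a symmetric integer interval, folded onto its nonnegative half. -/
theorem sum_Icc_neg_self_eq_sum_Icc_zero {M : Type*} [AddCommMonoid M] (g : ℤ → M) (m : ℕ) :
    ∑ n ∈ Finset.Icc (-(m : ℤ)) m, g n =
      ∑ n ∈ Finset.Icc (0 : ℤ) m, if n = 0 then g 0 else g n + g (-n) := by
  induction m with
  | zero => simp
  | succ m ih =>
    have hsymm : Finset.Icc (-((m + 1 : ℕ) : ℤ)) ((m + 1 : ℕ) : ℤ) =
        insert ((m : ℤ) + 1) (insert (-((m : ℤ) + 1)) (Finset.Icc (-(m : ℤ)) m)) := by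
      ext n
      simp only [Finset.mem_Icc, Finset.mem_insert]
      omega
    have hnonneg : Finset.Icc (0 : ℤ) ((m + 1 : ℕ) : ℤ) =
        insert ((m : ℤ) + 1) (Finset.Icc (0 : ℤ) m) := by
      ext n
      simp only [Finset.mem_Icc, Finset.mem_insert]
      omega
    have hm : (m : ℤ) + 1 ≠ 0 := by omega
    rw [hsymm, hnonneg, Finset.sum_insert (by simp; omega), Finset.sum_insert (by simp),
      Finset.sum_insert (by simp), ih, if_neg hm, add_assoc]

/-- Rewriting of Morton's cabling formula in terms of the vectors `f_l`. -/
theorem stmt_16 (q : ℤ) (i : ℕ) (hi : 1 ≤ i) (C x : ℂ) (hC : C ≠ 0) (hx : x ≠ 0) :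
    (∑ n ∈ (Finset.Icc (-((i : ℤ)-1)) ((i : ℤ)-1)).filter
        (fun n => n % 2 = ((i : ℤ)-1) % 2),
      C ^ (-(q*n^2 + 2*n)) * (x ^ (q*n+1) - x ^ (-(q*n+1)))) =
    ∑ n ∈ (Finset.Icc (0 : ℤ) ((i : ℤ)-1)).filter
        (fun n => n % 2 = ((i : ℤ)-1) % 2),
      (if n = 0 then x - x⁻¹
       else C ^ (-(q*n^2 + 2*n)) *
         ((x ^ (q*n+1) - x ^ (-(q*n+1))) - C ^ (4*n) * (x ^ (q*n-1) - x ^ (-(q*n-1))))) := by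
  obtain ⟨m, rfl⟩ : ∃ m, i = m + 1 := ⟨i - 1, by omega⟩
  have hm : ((m + 1 : ℕ) : ℤ) - 1 = m := by simp
  rw [hm, Finset.sum_filter, Finset.sum_filter, sum_Icc_neg_self_eq_sum_Icc_zero]
  refine Finset.sum_congr rfl fun n _ => ?_
  by_cases hn : n = 0
  · simp [hn]
  · have hparity : (-n) % 2 = (m : ℤ) % 2 ↔ n % 2 = (m : ℤ) % 2 := by omega
    simp only [hn, if_false, hparity]
    split_ifs
    · have hpow : C ^ (-(q * (-n) ^ 2 + 2 * -n)) = C ^ (-(q * n ^ 2 + 2 * n)) * C ^ (4 * n) := by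
        rw [← zpow_add₀ hC]
        ring_nf
      rw [hpow, show q * -n + 1 = -(q * n - 1) by ring, neg_neg]
      ring
    · simp
end
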